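/- arXiv:1511.03955 — 2 statements merged into one kernel-verified Lean document; each statement's English description precedes it below -/
import Mathlib

section
/- Let V be a finite-dimensional real inner product space and A : V → V an orthogonal linear map (i.e. ⟨Ax, Ay⟩ = ⟨x, y⟩ for all x, y ∈ V). Define the symmetric bilinear form β on V × V by β((x₁, y₁), (x₂, y₂)) = ⟨x₁, y₂⟩ + ⟨y₁, x₂⟩, and let L be the image of the linear map V → V × V, x ↦ ((1 − A)x, (1/4)(1 + A)x). Then β vanishes identically on L (i.e. β(u, v) = 0 for all u, v ∈ L) and dim L = dim V; consequently L is a maximal isotropic subspace of (V × V, β). -/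
open RealInnerProductSpace

/-- For an orthogonal endomorphism `A` of a finite-dimensional real inner product space `V`,
the image `L` of `x ↦ ((1 - A) x, (1/4)(1 + A) x)` in `V × V` is isotropic for the pairing
`β((x₁, y₁), (x₂, y₂)) = ⟪x₁, y₂⟫ + ⟪y₁, x₂⟫` and has the same dimension as `V`
(hence is maximal isotropic). -/
theorem cartanDirac_maximal_isotropic
    (V : Type*) [NormedAddCommGroup V] [InnerProductSpace ℝ V] [FiniteDimensional ℝ V]
    (A : V →ₗ[ℝ] V) (hA : ∀ x y : V, ⟪A x, A y⟫ = ⟪x, y⟫)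
    (L : Submodule ℝ (V × V))
    (hL : L = LinearMap.range ((1 - A).prod ((1 / 4 : ℝ) • (1 + A)))) :
    (∀ u ∈ L, ∀ v ∈ L, ⟪u.1, v.2⟫ + ⟪u.2, v.1⟫ = 0) ∧
      Module.finrank ℝ L = Module.finrank ℝ V := by
  subst hL
  constructor
  · rintro _ ⟨x, rfl⟩ _ ⟨y, rfl⟩
    simp only [LinearMap.prod_apply, Function.prod_apply, LinearMap.sub_apply, LinearMap.smul_apply,
      LinearMap.add_apply, Module.End.one_apply, inner_smul_left, inner_smul_right,
      inner_sub_left, inner_sub_right, inner_add_left, inner_add_right, hA, conj_trivial]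
    ring
  · apply LinearMap.finrank_range_of_inj
    rw [← LinearMap.ker_eq_bot, LinearMap.ker_eq_bot']
    intro x hx
    simp only [LinearMap.prod_apply, Function.prod_apply, LinearMap.sub_apply, LinearMap.smul_apply,
      LinearMap.add_apply, Module.End.one_apply, Prod.mk_eq_zero] at hx
    obtain ⟨hsub, hadd⟩ := hx
    calc x = (1 / 2 : ℝ) • (x - A x) + (2 : ℝ) • (1 / 4 : ℝ) • (x + A x) := by module
      _ = 0 := by rw [hsub, hadd]; simp
end

section
/- Let V be a finite-dimensional real inner product space and A : V → V an orthogonal linear map (i.e. ⟨Ax, Ay⟩ = ⟨x, y⟩ for all x, y ∈ V) such that 1 + A is invertible. Define the bilinear form σ on V by σ(x, y) = (1/2)(⟨Ax, y⟩ − ⟨x, Ay⟩). Then σ is alternating, its radical {x ∈ V : σ(x, y) = 0 for all y ∈ V} is exactly ker(A − 1), and the restriction of σ to the orthogonal complement of ker(A − 1) is nondegenerate. -/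
open RealInnerProductSpace

/-- For an orthogonal endomorphism `A` of a finite-dimensional real inner product space with
`1 + A` invertible, the form `σ(x, y) = (1/2)(⟪A x, y⟫ - ⟪x, A y⟫)` is alternating, its radical
is `ker (A - 1)`, and its restriction to the orthogonal complement of `ker (A - 1)` is
nondegenerate. -/
theorem conjugacy_class_form_nondegenerate
    (V : Type*) [NormedAddCommGroup V] [InnerProductSpace ℝ V] [FiniteDimensional ℝ V]
    (A : V →ₗ[ℝ] V) (hA : ∀ x y : V, ⟪A x, A y⟫ = ⟪x, y⟫)
    (hA1 : IsUnit (1 + A))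
    (σ : V → V → ℝ) (hσ : σ = fun x y => (1 / 2 : ℝ) * (⟪A x, y⟫ - ⟪x, A y⟫)) :
    (∀ x : V, σ x x = 0) ∧
    ({x : V | ∀ y : V, σ x y = 0} = LinearMap.ker (A - 1)) ∧
    (∀ x ∈ (LinearMap.ker (A - 1))ᗮ, (∀ y ∈ (LinearMap.ker (A - 1))ᗮ, σ x y = 0) → x = 0) := by
  subst hσ
  have mem_ker (x : V) : x ∈ LinearMap.ker (A - 1) ↔ A x = x := by
    simp [LinearMap.mem_ker, sub_eq_zero]
  have of_fixed (x y : V) (hx : A x = x) : ⟪A x, y⟫ - ⟪x, A y⟫ = 0 := by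
    have h := hA x y
    rw [hx] at h ⊢
    linarith
  have fixed_of_radical (x : V) (h : ∀ y : V, (1 / 2 : ℝ) * (⟪A x, y⟫ - ⟪x, A y⟫) = 0) :
      A x = x := by
    obtain ⟨z, hz⟩ := ((Module.End.isUnit_iff _).mp hA1).surjective x
    replace hz : z + A z = x := by simpa using hz
    have hAz : A x = A z + A (A z) := by rw [← hz, map_add]
    have inner_eq : ⟪x, A x⟫ = ⟪x, x⟫ := by
      have h1 := h (A z)
      rw [hA] at h1
      have h2 : ⟪x, A x⟫ = ⟪x, A z⟫ + ⟪x, A (A z)⟫ := by rw [hAz, inner_add_right]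
      have h3 : ⟪x, x⟫ = ⟪x, z⟫ + ⟪x, A z⟫ := by rw [← inner_add_right, hz]
      linarith
    have h4 : ⟪A x - x, A x - x⟫ = 0 := by
      rw [real_inner_sub_sub_self, hA, real_inner_comm x (A x), inner_eq]
      ring
    exact sub_eq_zero.mp (inner_self_eq_zero.mp h4)
  refine ⟨fun x => ?_, ?_, fun x hx h => ?_⟩
  · simp [real_inner_comm]
  · ext x
    rw [SetLike.mem_coe, mem_ker]
    exact ⟨fixed_of_radical x, fun hx y => by simp only [of_fixed x y hx, mul_zero]⟩
  · have hker : x ∈ LinearMap.ker (A - 1) := by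
      refine (mem_ker x).mpr (fixed_of_radical x fun y => ?_)
      obtain ⟨k, hk, p, hp, rfl⟩ := (LinearMap.ker (A - 1)).exists_add_mem_mem_orthogonal y
      have h1 := h p hp
      have h2 := of_fixed k x ((mem_ker k).mp hk)
      simp only [map_add, inner_add_right] at h1 ⊢
      rw [real_inner_comm, real_inner_comm (A x) k] at h2
      linarith
    exact inner_self_eq_zero.mp (hx x hker)
end
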